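/- arXiv:2207.09013 — 12 statements merged into one kernel-verified Lean document; each statement's English description precedes it below -/
import Mathlib

section
/- Let E be a real normed space, U ⊆ E open, and J : U → (E →L[ℝ] E) a differentiable map such that (J x) ∘ (J x) = −id for every x ∈ U and whose derivative is symmetric: (fderiv ℝ J x u) v = (fderiv ℝ J x v) u for all x ∈ U and u, v ∈ E. Then the Nijenhuis tensor of J vanishes: for all x ∈ U and u, v ∈ E, (fderiv ℝ J x ((J x) u)) v − (fderiv ℝ J x ((J x) v)) u + (J x)((fderiv ℝ J x v) u) − (J x)((fderiv ℝ J x u) v) = 0. -/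
/-- The derivative of a field of almost complex structures anticommutes with the field. -/
theorem fderiv_apply_apply_eq_neg_of_eventually_apply_apply_eq_neg
    {𝕜 : Type*} [NontriviallyNormedField 𝕜]
    {E F : Type*} [NormedAddCommGroup E] [NormedSpace 𝕜 E]
    [NormedAddCommGroup F] [NormedSpace 𝕜 F]
    {J : E → (F →L[𝕜] F)} {x : E} (hdiff : DifferentiableAt 𝕜 J x)
    (hJ : ∀ᶠ y in nhds x, ∀ v : F, J y (J y v) = -v) (w : E) (v : F) :
    fderiv 𝕜 J x w (J x v) = -J x (fderiv 𝕜 J x w v) := by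
  have hd := hdiff.hasFDerivAt
  have h₁ : HasFDerivAt (fun y => J y (J y v)) _ x :=
    hd.clm_apply (hd.clm_apply (hasFDerivAt_const v x))
  have h₂ : HasFDerivAt (fun y => J y (J y v)) (0 : E →L[𝕜] F) x :=
    (hasFDerivAt_const (-v) x).congr_of_eventuallyEq (hJ.mono fun y hy => hy v)
  have h := congrArg (fun L : E →L[𝕜] F => L w) (h₁.unique h₂)
  rw [eq_neg_iff_add_eq_zero, add_comm]
  simpa using h

/-- if `J x ∘ J x = -id` on an open set `U` and the derivative of `J` is
symmetric, then the Nijenhuis tensor of `J` vanishes on `U`. -/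
theorem nijenhuis_vanishes_of_symmetric_derivative
    {E : Type*} [NormedAddCommGroup E] [NormedSpace ℝ E]
    (U : Set E) (hU : IsOpen U)
    (J : E → (E →L[ℝ] E))
    (hdiff : ∀ x ∈ U, DifferentiableAt ℝ J x)
    (hJ : ∀ x ∈ U, ∀ v : E, J x (J x v) = -v)
    (hsym : ∀ x ∈ U, ∀ u v : E, fderiv ℝ J x u v = fderiv ℝ J x v u) :
    ∀ x ∈ U, ∀ u v : E,
      fderiv ℝ J x (J x u) v - fderiv ℝ J x (J x v) u
        + J x (fderiv ℝ J x v u) - J x (fderiv ℝ J x u v) = 0 := by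
  intro x hx u v
  have anticomm := fderiv_apply_apply_eq_neg_of_eventually_apply_apply_eq_neg (hdiff x hx)
    (Filter.eventually_of_mem (hU.mem_nhds hx) hJ)
  rw [hsym x hx (J x u) v, hsym x hx (J x v) u, anticomm, anticomm]
  abel
end

section
/- Let E be a real normed space, U ⊆ E open, and J : U → (E →L[ℝ] E) a differentiable map with (J x) ∘ (J x) = −id for all x ∈ U and symmetric derivative: (fderiv ℝ J x u) v = (fderiv ℝ J x v) u for all x, u, v. On Ω := U × E ⊆ E × E define the endomorphism fields I₁, I₂, I₃ : Ω → ((E × E) →L[ℝ] (E × E)) by I₁^{(x,y)}(u,v) = ((J x) u, −(J x) v), I₂^{(x,y)}(u,v) = (v, −u), I₃^{(x,y)}(u,v) = ((J x) v, (J x) u). Then the Nijenhuis tensor of each of I₁, I₂, I₃ vanishes identically on Ω, i.e. the canonical almost hypercomplex structure of the generalized rigid c-map is integrable. -/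
open ContinuousLinearMap

/-- The Nijenhuis tensor of an endomorphism field `I` on an open subset of a normed
space, evaluated at `x` on constant vector fields `u`, `v`. -/
noncomputable def nijenhuisTensor {F : Type*} [NormedAddCommGroup F] [NormedSpace ℝ F]
    (I : F → (F →L[ℝ] F)) (x : F) (u v : F) : F :=
  fderiv ℝ I x (I x u) v - fderiv ℝ I x (I x v) u
    + I x (fderiv ℝ I x v u) - I x (fderiv ℝ I x u v)

/-- The first endomorphism field of the rigid c-map: `I₁^{(x,y)}(u,v) = (J x u, -(J x) v)`. -/
noncomputable def cmapI₁ {E : Type*} [NormedAddCommGroup E] [NormedSpace ℝ E]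
    (J : E → (E →L[ℝ] E)) (p : E × E) : (E × E) →L[ℝ] (E × E) :=
  ((J p.1).comp (fst ℝ E E)).prod (-((J p.1).comp (snd ℝ E E)))

/-- The second endomorphism field of the rigid c-map: `I₂^{(x,y)}(u,v) = (v, -u)`. -/
noncomputable def cmapI₂ {E : Type*} [NormedAddCommGroup E] [NormedSpace ℝ E]
    (J : E → (E →L[ℝ] E)) (_p : E × E) : (E × E) →L[ℝ] (E × E) :=
  (snd ℝ E E).prod (-(fst ℝ E E))

/-- The third endomorphism field of the rigid c-map: `I₃^{(x,y)}(u,v) = ((J x) v, (J x) u)`. -/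
noncomputable def cmapI₃ {E : Type*} [NormedAddCommGroup E] [NormedSpace ℝ E]
    (J : E → (E →L[ℝ] E)) (p : E × E) : (E × E) →L[ℝ] (E × E) :=
  ((J p.1).comp (snd ℝ E E)).prod ((J p.1).comp (fst ℝ E E))

section

variable {E : Type*} [NormedAddCommGroup E] [NormedSpace ℝ E] {J : E → (E →L[ℝ] E)}

/-- Sandwiching the pullback of `J` along the first projection between constant linear maps. -/
theorem hasFDerivAt_comp_fst_comp {G : Type*} [NormedAddCommGroup G] [NormedSpace ℝ G]
    {p : E × E} (h : DifferentiableAt ℝ J p.1) (A : G →L[ℝ] E) (B : E →L[ℝ] G) :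
    HasFDerivAt (fun q : E × E => B.comp ((J q.1).comp A))
      ((compL ℝ G E G B).comp (((compL ℝ G E E).flip A).comp
        ((fderiv ℝ J p.1).comp (fst ℝ E E)))) p :=
  (compL ℝ G E G B).hasFDerivAt.comp p
    (((compL ℝ G E E).flip A).hasFDerivAt.comp p (h.hasFDerivAt.comp p hasFDerivAt_fst))

theorem fderiv_cmapI₁_apply {p : E × E} (h : DifferentiableAt ℝ J p.1) (w v : E × E) :
    fderiv ℝ (cmapI₁ J) p w v = (fderiv ℝ J p.1 w.1 v.1, -fderiv ℝ J p.1 w.1 v.2) := by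
  have e : cmapI₁ J = (fun q : E × E => (inl ℝ E E).comp ((J q.1).comp (fst ℝ E E))) -
      fun q : E × E => (inr ℝ E E).comp ((J q.1).comp (snd ℝ E E)) := by
    funext q
    ext <;> simp [cmapI₁]
  rw [e, ((hasFDerivAt_comp_fst_comp h _ _).sub (hasFDerivAt_comp_fst_comp h _ _)).fderiv]
  ext <;> simp

theorem fderiv_cmapI₃_apply {p : E × E} (h : DifferentiableAt ℝ J p.1) (w v : E × E) :
    fderiv ℝ (cmapI₃ J) p w v = (fderiv ℝ J p.1 w.1 v.2, fderiv ℝ J p.1 w.1 v.1) := by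
  have e : cmapI₃ J = (fun q : E × E => (inl ℝ E E).comp ((J q.1).comp (snd ℝ E E))) +
      fun q : E × E => (inr ℝ E E).comp ((J q.1).comp (fst ℝ E E)) := by
    funext q
    ext <;> simp [cmapI₃]
  rw [e, ((hasFDerivAt_comp_fst_comp h _ _).add (hasFDerivAt_comp_fst_comp h _ _)).fderiv]
  ext <;> simp

/-- The derivative of an almost complex structure anticommutes with it. -/
theorem apply_fderiv_eq_neg_of_sq_eq_neg {U : Set E} (hU : IsOpen U) {x : E} (hx : x ∈ U)
    (h : DifferentiableAt ℝ J x) (hJ : ∀ x ∈ U, ∀ v : E, J x (J x v) = -v) (w v : E) :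
    J x (fderiv ℝ J x w v) = -fderiv ℝ J x w (J x v) := by
  have hv : HasFDerivAt (fun y => J y v) ((fderiv ℝ J x).flip v) x := by
    simpa using h.hasFDerivAt.clm_apply (hasFDerivAt_const v x)
  have hc : (fun y => J y (J y v)) =ᶠ[nhds x] fun _ => -v :=
    Filter.eventually_of_mem (hU.mem_nhds hx) fun y hy => hJ y hy v
  have key := DFunLike.congr_fun ((h.hasFDerivAt.clm_apply hv).unique
    ((hasFDerivAt_const (-v) x).congr_of_eventuallyEq hc)) w
  exact eq_neg_of_add_eq_zero_left (by simpa using key)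

end

/-- the canonical almost hypercomplex structure of the generalized rigid
c-map is integrable: the Nijenhuis tensors of `I₁`, `I₂`, `I₃` vanish on `Ω = U × E`. -/
theorem rigid_cmap_hypercomplex_integrable
    {E : Type*} [NormedAddCommGroup E] [NormedSpace ℝ E]
    (U : Set E) (hU : IsOpen U)
    (J : E → (E →L[ℝ] E))
    (hdiff : ∀ x ∈ U, DifferentiableAt ℝ J x)
    (hJ : ∀ x ∈ U, ∀ v : E, J x (J x v) = -v)
    (hsym : ∀ x ∈ U, ∀ u v : E, fderiv ℝ J x u v = fderiv ℝ J x v u) :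
    ∀ p : E × E, p.1 ∈ U → ∀ u v : E × E,
      nijenhuisTensor (cmapI₁ J) p u v = 0 ∧
      nijenhuisTensor (cmapI₂ J) p u v = 0 ∧
      nijenhuisTensor (cmapI₃ J) p u v = 0 := by
  intro p hp u v
  have hd := hdiff p.1 hp
  have anti := apply_fderiv_eq_neg_of_sq_eq_neg hU hp hd hJ
  have sym := hsym p.1 hp
  have swap (a b : E) : fderiv ℝ J p.1 a (J p.1 b) = fderiv ℝ J p.1 b (J p.1 a) := by
    rw [← neg_inj, ← anti, ← anti, sym a b]
  refine ⟨?_, ?_, ?_⟩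
  · simp only [nijenhuisTensor, fderiv_cmapI₁_apply hd]
    ext
    · simp [cmapI₁, anti, sym (J p.1 _)]
      abel
    · simp [cmapI₁, anti, sym (J p.1 _), swap u.1 v.2, swap v.1 u.2]
  · have h : fderiv ℝ (cmapI₂ J) p = 0 := fderiv_const_apply _
    simp [nijenhuisTensor, h]
  · simp only [nijenhuisTensor, fderiv_cmapI₃_apply hd]
    ext
    · simp [cmapI₃, sym (J p.1 _), sym v.1 u.1, swap u.2 v.2]
    · simp [cmapI₃, sym (J p.1 _), anti, swap u.1 v.2, swap v.1 u.2]
      abel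
end

section
/- Let E be a real normed space, U ⊆ E open, and J : U → (E →L[ℝ] E) a twice continuously differentiable map with (J x) ∘ (J x) = −id for every x ∈ U. Define S : U → E → (E →L[ℝ] E) by S x u := −(1/2) (J x) ∘ (fderiv ℝ J x u). Then for every x ∈ U and u, v ∈ E: fderiv ℝ (fun y => S y v) x u − fderiv ℝ (fun y => S y u) x v + (S x u) ∘ (S x v) − (S x v) ∘ (S x u) = −(1/4) ((fderiv ℝ J x u) ∘ (fderiv ℝ J x v) − (fderiv ℝ J x v) ∘ (fderiv ℝ J x u)). -/
/-- The derivative of `c J ∘ (DJ v)` along `u`, for a map `J` into a space of endomorphisms. -/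
theorem ContDiffAt.fderiv_comp_fderiv_apply
    {E : Type*} [NormedAddCommGroup E] [NormedSpace ℝ E]
    {J : E → (E →L[ℝ] E)} {x : E} (hJ : ContDiffAt ℝ 2 J x) (c : ℝ) (u v : E) :
    fderiv ℝ (fun y => c • (J y).comp (fderiv ℝ J y v)) x u
      = c • ((J x).comp (fderiv ℝ (fderiv ℝ J) x u v)
          + (fderiv ℝ J x u).comp (fderiv ℝ J x v)) := by
  have hd : HasFDerivAt J (fderiv ℝ J x) x := (hJ.differentiableAt two_ne_zero).hasFDerivAt
  have hd2 : HasFDerivAt (fderiv ℝ J) (fderiv ℝ (fderiv ℝ J) x) x :=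
    ((hJ.fderiv_right (m := 1) (by norm_num)).differentiableAt one_ne_zero).hasFDerivAt
  have h := (hd.clm_comp (hd2.clm_apply (hasFDerivAt_const v x))).const_smul c
  refine (DFunLike.congr_fun h.fderiv u).trans ?_
  ext w
  simp

/-- The derivative of a field of almost complex structures anticommutes with it. -/
theorem fderiv_comp_self_of_sq_eq_neg_one
    {E : Type*} [NormedAddCommGroup E] [NormedSpace ℝ E]
    {J : E → (E →L[ℝ] E)} {x : E} (hd : DifferentiableAt ℝ J x)
    (hJ : ∀ᶠ y in nhds x, ∀ v : E, J y (J y v) = -v) (u w : E) :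
    fderiv ℝ J x u (J x w) = -J x (fderiv ℝ J x u w) := by
  have h := hd.hasFDerivAt.clm_comp hd.hasFDerivAt
  have hc : (fun y => (J y).comp (J y)) =ᶠ[nhds x] fun _ => -ContinuousLinearMap.id ℝ E := by
    filter_upwards [hJ] with y hy
    ext v
    simp [hy]
  have h0 := h.unique ((hasFDerivAt_const _ x).congr_of_eventuallyEq hc)
  have h1 := congrArg (fun L => L u w) h0
  simp only [add_apply, ContinuousLinearMap.comp_apply,
    ContinuousLinearMap.compL_apply, ContinuousLinearMap.flip_apply,
    zero_apply] at h1
  exact eq_neg_of_add_eq_zero_right h1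

/-- curvature formula `R^{∇'} = -(1/4)[A_X, A_Y]` for the connection
`∇' = ∇ - (1/2) J (∇J)` of a special complex manifold, in affine coordinates. -/
theorem curvature_of_special_complex_connection
    {E : Type*} [NormedAddCommGroup E] [NormedSpace ℝ E]
    (U : Set E) (hU : IsOpen U)
    (J : E → (E →L[ℝ] E))
    (hJ2 : ContDiffOn ℝ 2 J U)
    (hJ : ∀ x ∈ U, ∀ v : E, J x (J x v) = -v)
    (S : E → E → (E →L[ℝ] E))
    (hS : ∀ x : E, ∀ u : E, S x u = -(1/2 : ℝ) • ((J x).comp (fderiv ℝ J x u))) :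
    ∀ x ∈ U, ∀ u v : E,
      fderiv ℝ (fun y => S y v) x u - fderiv ℝ (fun y => S y u) x v
        + (S x u).comp (S x v) - (S x v).comp (S x u)
      = -(1/4 : ℝ) • ((fderiv ℝ J x u).comp (fderiv ℝ J x v)
          - (fderiv ℝ J x v).comp (fderiv ℝ J x u)) := by
  intro x hx u v
  have hU' : U ∈ nhds x := hU.mem_nhds hx
  have hJx : ContDiffAt ℝ 2 J x := hJ2.contDiffAt hU'
  have hanti := fderiv_comp_self_of_sq_eq_neg_one (hJx.differentiableAt two_ne_zero)
    (Filter.mem_of_superset hU' hJ)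
  have hsymm : fderiv ℝ (fderiv ℝ J) x u v = fderiv ℝ (fderiv ℝ J) x v u :=
    (hJx.isSymmSndFDerivAt (by simp)).eq u v
  simp only [hS, hJx.fderiv_comp_fderiv_apply, hsymm]
  ext w
  simp only [add_apply, sub_apply,
    smul_apply, ContinuousLinearMap.comp_apply, map_smul, hanti,
    map_neg, hJ x hx]
  module
end

section
/- Let E be a real normed space, U ⊆ E open, and J : U → (E →L[ℝ] E) differentiable with (J x) ∘ (J x) = −id on U, symmetric derivative ((fderiv ℝ J x u) v = (fderiv ℝ J x v) u), and satisfying the conical condition fderiv ℝ J x x = 0 for all x ∈ U. Then: (i) fderiv ℝ J x ((J x) x) = 0 for every x ∈ U (i.e. A_{Jξ} = 0); and (ii) the vector field W(x) := (J x) x satisfies, for every constant vector u ∈ E and every x ∈ U, [W, P](x) − (J x)([W, C](x)) = 0, where P(y) := (J y) u, C(y) := u, and [V₁,V₂](x) := fderiv ℝ V₂ x (V₁ x) − fderiv ℝ V₁ x (V₂ x) is the Lie bracket of vector fields (i.e. L_{Jξ} J = 0). -/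
/-- The Lie bracket of vector fields on an open subset of a normed space,
`[V₁,V₂](x) = fderiv ℝ V₂ x (V₁ x) − fderiv ℝ V₁ x (V₂ x)`. -/
noncomputable def vfLieBracket {E : Type*} [NormedAddCommGroup E] [NormedSpace ℝ E]
    (V₁ V₂ : E → E) (x : E) : E :=
  fderiv ℝ V₂ x (V₁ x) - fderiv ℝ V₁ x (V₂ x)

/-- Differentiating `J² = -id`: each derivative of an almost complex structure `J` anticommutes
with `J`. -/
theorem fderiv_apply_almost_complex {E : Type*} [NormedAddCommGroup E] [NormedSpace ℝ E]
    {J : E → (E →L[ℝ] E)} {x : E} (hd : DifferentiableAt ℝ J x)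
    (hJ : ∀ᶠ y in nhds x, ∀ v : E, J y (J y v) = -v) (u v : E) :
    fderiv ℝ J x u (J x v) = -J x (fderiv ℝ J x u v) := by
  have h₁ : HasFDerivAt (fun y => J y (J y v)) _ x :=
    hd.hasFDerivAt.clm_apply (hd.hasFDerivAt.clm_apply (hasFDerivAt_const v x))
  have h₂ : HasFDerivAt (fun y => J y (J y v)) (0 : E →L[ℝ] E) x :=
    (hasFDerivAt_const (-v) x).congr_of_eventuallyEq (hJ.mono fun y hy => hy v)
  have h := DFunLike.congr_fun (h₁.unique h₂) u
  simp at h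
  exact eq_neg_of_add_eq_zero_right h

/-- for a conical special complex manifold in affine coordinates,
`A_{Jξ} = 0` and `L_{Jξ} J = 0`. -/
theorem conical_special_complex_LJxiJ
    {E : Type*} [NormedAddCommGroup E] [NormedSpace ℝ E]
    (U : Set E) (hU : IsOpen U)
    (J : E → (E →L[ℝ] E))
    (hdiff : ∀ x ∈ U, DifferentiableAt ℝ J x)
    (hJ : ∀ x ∈ U, ∀ v : E, J x (J x v) = -v)
    (hsym : ∀ x ∈ U, ∀ u v : E, fderiv ℝ J x u v = fderiv ℝ J x v u)
    (hconical : ∀ x ∈ U, fderiv ℝ J x x = 0) :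
    (∀ x ∈ U, fderiv ℝ J x (J x x) = 0) ∧
    (∀ x ∈ U, ∀ u : E,
      vfLieBracket (fun y => J y y) (fun y => J y u) x
        - J x (vfLieBracket (fun y => J y y) (fun _ => u) x) = 0) := by
  have hA : ∀ x ∈ U, fderiv ℝ J x (J x x) = 0 := by
    intro x hx
    ext u
    rw [hsym x hx, fderiv_apply_almost_complex (hdiff x hx)
      (Filter.eventually_of_mem (hU.mem_nhds hx) hJ), hsym x hx, hconical x hx]
    simp
  refine ⟨hA, fun x hx u => ?_⟩
  have hd := (hdiff x hx).hasFDerivAt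
  have hW := (hd.clm_apply (hasFDerivAt_id x)).fderiv
  have hP := (hd.clm_apply (hasFDerivAt_const u x)).fderiv
  simp only [id] at hW
  simp [vfLieBracket, hW, hP, hA x hx, hsym x hx _ x, hconical x hx, hJ x hx]
end

section
/- Let E be a finite-dimensional real normed space, U ⊆ E open, and J : U → (E →L[ℝ] E) twice differentiable with (J x) ∘ (J x) = −id for every x ∈ U. Then for all x ∈ U and u, v ∈ E: trace((J x) ∘ H(u,v)) + trace((fderiv ℝ J x u) ∘ (fderiv ℝ J x v)) = 0, where H(u,v) := fderiv ℝ (fun y => fderiv ℝ J y v) x u is the second derivative of J. -/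
/-- The derivative of a product of operator-valued maps whose product is locally constant satisfies
the Leibniz relation `f x ∘ g' u + f' u ∘ g x = 0`. -/
theorem comp_add_comp_eq_zero_of_eventuallyEq_const
    {E : Type*} [NormedAddCommGroup E] [NormedSpace ℝ E]
    {f g : E → (E →L[ℝ] E)} {f' g' : E →L[ℝ] (E →L[ℝ] E)} {x : E} {c : E →L[ℝ] E}
    (hf : HasFDerivAt f f' x) (hg : HasFDerivAt g g' x)
    (h : (fun y => (f y).comp (g y)) =ᶠ[nhds x] fun _ => c) (u : E) :
    (f x).comp (g' u) + (f' u).comp (g x) = 0 := by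
  have h1 := (hf.clm_comp hg).unique ((hasFDerivAt_const c x).congr_of_eventuallyEq h)
  simpa using DFunLike.congr_fun h1 u

/-- the trace identity `Tr J(H^∇_{X,Y} J) + Tr (A_X ∘ A_Y) = 0`, key to
the Ricci-flatness of the Obata connection of the generalized rigid c-map. -/
theorem trace_identity_rigid_cmap
    {E : Type*} [NormedAddCommGroup E] [NormedSpace ℝ E] [FiniteDimensional ℝ E]
    (U : Set E) (hU : IsOpen U)
    (J : E → (E →L[ℝ] E))
    (hdiff : ∀ x ∈ U, DifferentiableAt ℝ J x)
    (hdiff2 : ∀ x ∈ U, DifferentiableAt ℝ (fun y => fderiv ℝ J y) x)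
    (hJ : ∀ x ∈ U, ∀ v : E, J x (J x v) = -v) :
    ∀ x ∈ U, ∀ u v : E,
      LinearMap.trace ℝ E
          ((J x).comp (fderiv ℝ (fun y => fderiv ℝ J y v) x u)).toLinearMap
        + LinearMap.trace ℝ E
            ((fderiv ℝ J x u).comp (fderiv ℝ J x v)).toLinearMap = 0 := by
  intro x hx u v
  have first : ∀ y ∈ U, (J y).comp (fderiv ℝ J y v) + (fderiv ℝ J y v).comp (J y) = 0 := by
    intro y hy
    refine comp_add_comp_eq_zero_of_eventuallyEq_const (c := -ContinuousLinearMap.id ℝ E)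
      (hdiff y hy).hasFDerivAt (hdiff y hy).hasFDerivAt ?_ v
    filter_upwards [hU.mem_nhds hy] with z hz
    ext w
    simpa using hJ z hz w
  have hA : HasFDerivAt (fun y => fderiv ℝ J y v) (fderiv ℝ (fun y => fderiv ℝ J y v) x) x :=
    ((hdiff2 x hx).clm_apply (differentiableAt_const v)).hasFDerivAt
  have hJx := (hdiff x hx).hasFDerivAt
  generalize fderiv ℝ (fun y => fderiv ℝ J y v) x = H at hA ⊢
  have h0 : (fun y => (J y).comp (fderiv ℝ J y v) + (fderiv ℝ J y v).comp (J y))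
      =ᶠ[nhds x] fun _ => (0 : E →L[ℝ] E) := by
    filter_upwards [hU.mem_nhds hx] with y hy using first y hy
  have second := DFunLike.congr_fun (((hJx.clm_comp hA).add (hA.clm_comp hJx)).unique
    ((hasFDerivAt_const (0 : E →L[ℝ] E) x).congr_of_eventuallyEq h0)) u
  have htr := congrArg (fun T : E →L[ℝ] E => LinearMap.trace ℝ E T.toLinearMap) second
  have hc : ∀ S T : E →L[ℝ] E, LinearMap.trace ℝ E (S.comp T).toLinearMap
      = LinearMap.trace ℝ E (T.comp S).toLinearMap := fun S T =>
    LinearMap.trace_mul_comm ℝ S.toLinearMap T.toLinearMap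
  have e1 := hc (J x) (H u)
  have e2 := hc (fderiv ℝ J x u) (fderiv ℝ J x v)
  simp only [add_apply, ContinuousLinearMap.comp_apply,
    ContinuousLinearMap.flip_apply, ContinuousLinearMap.compL_apply,
    zero_apply, ContinuousLinearMap.toLinearMap_add,
    ContinuousLinearMap.toLinearMap_zero, map_add, map_zero] at htr
  linarith
end

section
/- Let V be a real vector space, n ≥ 2 a natural number, and J : V → V an ℝ-linear map with J ∘ J = −id. Let a and 𝓑 be ℝ-bilinear forms on V, with 𝓑 symmetric and J-hermitian: 𝓑(v,u) = 𝓑(u,v) and 𝓑(J u, J v) = 𝓑(u,v) for all u,v. Define Ric(u,v) := (1/4) 𝓑(u,v) − (2n+1) a(u,v) + a(v,u) − a(J u, J v) − a(J v, J u), let Ric^s(u,v) := (1/2)(Ric(u,v) + Ric(v,u)), and define the Rho tensor P(u,v) := (1/(n+1)) ( Ric(u,v) + (1/(n−1)) ( Ric^s(u,v) − Ric^s(J u, J v) ) ). Then a = (1/(8(n+1))) 𝓑 − (1/2) P, i.e. a(u,v) = (1/(8(n+1))) 𝓑(u,v) − (1/2) P(u,v) for all u,v ∈ V. -/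
variable {V : Type*} [AddCommGroup V] [Module ℝ V]

/-- The Ricci tensor of the induced connection on a projective special complex
manifold, expressed in terms of `𝓑(Y,Z) = Tr B̄_Y B̄_Z` and the tensor `a`. -/
noncomputable def psRic (n : ℕ) (J : V →ₗ[ℝ] V)
    (a 𝓑 : V →ₗ[ℝ] V →ₗ[ℝ] ℝ) (u v : V) : ℝ :=
  (1/4) * 𝓑 u v - (2 * (n : ℝ) + 1) * a u v + a v u - a (J u) (J v) - a (J v) (J u)

/-- Symmetrization of `psRic`. -/
noncomputable def psRicSymm (n : ℕ) (J : V →ₗ[ℝ] V)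
    (a 𝓑 : V →ₗ[ℝ] V →ₗ[ℝ] ℝ) (u v : V) : ℝ :=
  (1/2) * (psRic n J a 𝓑 u v + psRic n J a 𝓑 v u)

/-- The Rho tensor of the induced connection (with `m = n`, `dim = 2n`). -/
noncomputable def psRho (n : ℕ) (J : V →ₗ[ℝ] V)
    (a 𝓑 : V →ₗ[ℝ] V →ₗ[ℝ] ℝ) (u v : V) : ℝ :=
  (1/((n : ℝ) + 1)) * (psRic n J a 𝓑 u v
    + (1/((n : ℝ) - 1)) * (psRicSymm n J a 𝓑 u v - psRicSymm n J a 𝓑 (J u) (J v)))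

/-- the identity `a = 𝓑/(8(n+1)) − P/2` (equation (7.6) of the paper). -/
theorem a_eq_B_sub_rho (n : ℕ) (hn : 2 ≤ n)
    (J : V →ₗ[ℝ] V) (hJ : ∀ v : V, J (J v) = -v)
    (a 𝓑 : V →ₗ[ℝ] V →ₗ[ℝ] ℝ)
    (hBsymm : ∀ u v : V, 𝓑 v u = 𝓑 u v)
    (hBherm : ∀ u v : V, 𝓑 (J u) (J v) = 𝓑 u v) :
    ∀ u v : V,
      a u v = (1/(8 * ((n : ℝ) + 1))) * 𝓑 u v - (1/2) * psRho n J a 𝓑 u v := by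
  intro u v
  have hn1 : (n : ℝ) - 1 ≠ 0 := by
    have : (2 : ℝ) ≤ n := by exact_mod_cast hn
    linarith
  have hn2 : (n : ℝ) + 1 ≠ 0 := by positivity
  simp only [psRho, psRicSymm, psRic, hJ, hBherm, hBsymm u v, map_neg, LinearMap.neg_apply, neg_neg]
  field_simp
  ring
end

section
/- Let V be a real vector space, n a natural number, and J : V → V an ℝ-linear map with J ∘ J = −id. Let B assign to each X ∈ V an endomorphism B_X of V, linearly in X, such that B_{JX} = −J ∘ B_X and B_X ∘ J = −J ∘ B_X for all X ∈ V. Let 𝓑 be a symmetric J-hermitian bilinear form on V (𝓑(JX,JY) = 𝓑(X,Y)). Define the End(V)-valued two-form W by W_{X,Y} Z := −(1/4)(B_X (B_Y Z) − B_Y (B_X Z)) − (1/(4(n+1))) 𝓑(X, J Y) · (J Z) + (1/(8(n+1))) (𝓑(X,Z) Y − 𝓑(Y,Z) X) − (1/(8(n+1))) (𝓑(X, J Z) (J Y) − 𝓑(Y, J Z) (J X)). Then W is of type (1,1): W_{JX, JY} = W_{X,Y} for all X, Y ∈ V. -/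
variable {V : Type*} [AddCommGroup V] [Module ℝ V]

/-- The c-projective Weyl curvature
`W = −(1/4)[B,B] − (1/(4(n+1))) 𝓑_J ⊗ J + (1/(8(n+1)))(𝓑 ∧ Id − 𝓑_J ∧ J)`. -/
noncomputable def cprojWeyl (n : ℕ) (J : V →ₗ[ℝ] V)
    (B : V →ₗ[ℝ] Module.End ℝ V) (𝓑 : V →ₗ[ℝ] V →ₗ[ℝ] ℝ) (X Y Z : V) : V :=
  -(1/4 : ℝ) • (B X (B Y Z) - B Y (B X Z))
    - (1/(4 * ((n : ℝ) + 1))) • (𝓑 X (J Y) • J Z)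
    + (1/(8 * ((n : ℝ) + 1))) • (𝓑 X Z • Y - 𝓑 Y Z • X)
    - (1/(8 * ((n : ℝ) + 1))) • (𝓑 X (J Z) • J Y - 𝓑 Y (J Z) • J X)

/-- the c-projective Weyl curvature of the canonical c-projective
structure of a projective special complex manifold is of type (1,1):
`W_{JX,JY} = W_{X,Y}`. -/
theorem cprojWeyl_type_one_one (n : ℕ)
    (J : V →ₗ[ℝ] V) (hJ : ∀ v : V, J (J v) = -v)
    (B : V →ₗ[ℝ] Module.End ℝ V)
    (hBJ : ∀ X : V, B (J X) = -(J ∘ₗ B X))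
    (hBJ' : ∀ X : V, (B X) ∘ₗ J = -(J ∘ₗ B X))
    (𝓑 : V →ₗ[ℝ] V →ₗ[ℝ] ℝ)
    (hBsymm : ∀ X Y : V, 𝓑 Y X = 𝓑 X Y)
    (hBherm : ∀ X Y : V, 𝓑 (J X) (J Y) = 𝓑 X Y) :
    ∀ X Y Z : V, cprojWeyl n J B 𝓑 (J X) (J Y) Z = cprojWeyl n J B 𝓑 X Y Z := by
  intro X Y Z
  have hB : ∀ X v, B (J X) v = -J (B X v) := fun X v => by
    simpa using LinearMap.congr_fun (hBJ X) v
  have hB' : ∀ X v, B X (J v) = -J (B X v) := fun X v => by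
    simpa using LinearMap.congr_fun (hBJ' X) v
  have hskew : ∀ X Z, 𝓑 (J X) Z = -𝓑 X (J Z) := fun X Z => by
    rw [← hBherm (J X) Z, hJ, map_neg, LinearMap.neg_apply]
  simp only [cprojWeyl, hB, hB', hskew, hJ, map_neg, neg_neg]
  module
end

section
/- Let V be a real vector space, n ≥ 1 a natural number, and J : V → V ℝ-linear with J ∘ J = −id. Let B assign linearly to each X ∈ V an endomorphism B_X of V, let P be a bilinear form on V, and let 𝓑 be a symmetric J-hermitian bilinear form (𝓑(JX,JY) = 𝓑(X,Y)). Set a := (1/(8(n+1))) 𝓑 − (1/2) P. For a bilinear form b write b^a(X,Y) := (1/2)(b(X,Y) − b(Y,X)) and b_J(X,Y) := b(X,JY), and for an endomorphism K write (b ∧ K)_{X,Y}Z := b(X,Z) K Y − b(Y,Z) K X. Define R_{X,Y} := −(1/4)(B_X∘B_Y − B_Y∘B_X) + 2 a^a(X,Y) · id − 2 (a_J)^a(X,Y) · J + (a ∧ id)_{X,Y} − (a_J ∧ J)_{X,Y}, and W_{X,Y} := R_{X,Y} + P^a(X,Y) · id − (P_J)^a(X,Y) · J + (1/2)(P ∧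 id)_{X,Y} − (1/2)(P_J ∧ J)_{X,Y}. Then W_{X,Y} = −(1/4)(B_X∘B_Y − B_Y∘B_X) − (1/(4(n+1))) 𝓑_J(X,Y) · J + (1/(8(n+1)))((𝓑 ∧ id)_{X,Y} − (𝓑_J ∧ J)_{X,Y}) for all X, Y ∈ V. -/
variable {V : Type*} [AddCommGroup V] [Module ℝ V]

/-- Antisymmetrization `b^a(X,Y) = (1/2)(b(X,Y) − b(Y,X))` of a bilinear form. -/
noncomputable def formAnti (b : V → V → ℝ) (X Y : V) : ℝ := (1/2) * (b X Y - b Y X)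

/-- `b_J(X,Y) = b(X, JY)`. -/
def formJ (J : V →ₗ[ℝ] V) (b : V → V → ℝ) (X Y : V) : ℝ := b X (J Y)

/-- `(b ∧ K)_{X,Y} Z = b(X,Z) K Y − b(Y,Z) K X`. -/
def formWedge (b : V → V → ℝ) (K : V →ₗ[ℝ] V) (X Y Z : V) : V :=
  b X Z • K Y - b Y Z • K X

/-- The curvature `R` of the induced complex connection `∇̄′`, expressed through
`B`, `a` and `J` (Proposition 7.5 of the paper). -/
noncomputable def psCurvR (J : V →ₗ[ℝ] V) (B : V →ₗ[ℝ] Module.End ℝ V)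
    (a : V → V → ℝ) (X Y Z : V) : V :=
  -(1/4 : ℝ) • (B X (B Y Z) - B Y (B X Z))
    + (2 * formAnti a X Y) • Z - (2 * formAnti (formJ J a) X Y) • J Z
    + formWedge a (LinearMap.id : V →ₗ[ℝ] V) X Y Z - formWedge (formJ J a) J X Y Z

/-- The c-projective Weyl curvature
`W = R + P^a ⊗ id − (P_J)^a ⊗ J + (1/2) P ∧ id − (1/2) P_J ∧ J`. -/
noncomputable def psWeylW (J : V →ₗ[ℝ] V) (B : V →ₗ[ℝ] Module.End ℝ V)
    (a P : V → V → ℝ) (X Y Z : V) : V :=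
  psCurvR J B a X Y Z
    + formAnti P X Y • Z - formAnti (formJ J P) X Y • J Z
    + (1/2 : ℝ) • formWedge P (LinearMap.id : V →ₗ[ℝ] V) X Y Z
    - (1/2 : ℝ) • formWedge (formJ J P) J X Y Z

/-- with `a = 𝓑/(8(n+1)) − P/2`, the c-projective Weyl curvature has
the explicit form `W = −(1/4)[B,B] − (1/(4(n+1))) 𝓑_J ⊗ J + (1/(8(n+1)))(𝓑 ∧ id − 𝓑_J ∧ J)`
(computation in the proof of Theorem 7.8). -/
theorem weyl_explicit_formula (n : ℕ) (hn : 1 ≤ n)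
    (J : V →ₗ[ℝ] V) (hJ : ∀ v : V, J (J v) = -v)
    (B : V →ₗ[ℝ] Module.End ℝ V)
    (P 𝓑 : V →ₗ[ℝ] V →ₗ[ℝ] ℝ)
    (hBsymm : ∀ X Y : V, 𝓑 Y X = 𝓑 X Y)
    (hBherm : ∀ X Y : V, 𝓑 (J X) (J Y) = 𝓑 X Y)
    (a : V → V → ℝ)
    (ha : ∀ X Y : V, a X Y = (1/(8 * ((n : ℝ) + 1))) * 𝓑 X Y - (1/2) * P X Y) :
    ∀ X Y Z : V,
      psWeylW J B a (fun u v => P u v) X Y Z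
        = -(1/4 : ℝ) • (B X (B Y Z) - B Y (B X Z))
          - (1/(4 * ((n : ℝ) + 1)) * formJ J (fun u v => 𝓑 u v) X Y) • J Z
          + (1/(8 * ((n : ℝ) + 1)))
              • (formWedge (fun u v => 𝓑 u v) (LinearMap.id : V →ₗ[ℝ] V) X Y Z
                  - formWedge (formJ J (fun u v => 𝓑 u v)) J X Y Z) := by
  intro X Y Z
  have hskew : 𝓑 Y (J X) = -𝓑 X (J Y) := by
    rw [hBsymm, ← hBherm (J X) Y, hJ, map_neg, LinearMap.neg_apply]
  have hc : 1 / (4 * ((n : ℝ) + 1)) = 2 * (1 / (8 * ((n : ℝ) + 1))) := by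
    field_simp
    norm_num
  simp only [psWeylW, psCurvR, formWedge, formAnti, formJ, ha, hskew, hBsymm X Y, hc,
    LinearMap.id_apply]
  module
end

section
/- Let E be a real normed space, U ⊆ E open, ψ : E →L[ℝ] E →L[ℝ] ℝ a continuous bilinear form which is antisymmetric (ψ(u,v) = −ψ(v,u)), and J : U → (E →L[ℝ] E) differentiable with (J x) ∘ (J x) = −id, pointwise J-hermitian ψ (ψ((J x) u, (J x) v) = ψ(u,v) for all x ∈ U, u, v ∈ E), symmetric derivative ((fderiv ℝ J x u) v = (fderiv ℝ J x v) u), and conical condition fderiv ℝ J x x = 0 for all x ∈ U. Define μ : U → ℝ by μ(x) := (1/2) ψ(x, (J x) x). Then μ is differentiable and fderiv ℝ μ x v = −ψ((J x) x, v) for all x ∈ U and v ∈ E; i.e. dμ = −ι_Z ψ for the vector field Z(x) = (J x) x. -/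
/-- for a conical special complex manifold with a parallel `J`-hermitian
two-form `ψ` (in affine coordinates), the moment map `μ = (1/2) ψ(ξ, Jξ)` satisfies
`dμ = −ι_Z ψ` for `Z = Jξ`. -/
theorem moment_map_derivative
    {E : Type*} [NormedAddCommGroup E] [NormedSpace ℝ E]
    (U : Set E) (hU : IsOpen U)
    (ψ : E →L[ℝ] E →L[ℝ] ℝ)
    (hanti : ∀ u v : E, ψ u v = -ψ v u)
    (J : E → (E →L[ℝ] E))
    (hdiff : ∀ x ∈ U, DifferentiableAt ℝ J x)
    (hJ : ∀ x ∈ U, ∀ v : E, J x (J x v) = -v)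
    (hherm : ∀ x ∈ U, ∀ u v : E, ψ (J x u) (J x v) = ψ u v)
    (hsym : ∀ x ∈ U, ∀ u v : E, fderiv ℝ J x u v = fderiv ℝ J x v u)
    (hconical : ∀ x ∈ U, fderiv ℝ J x x = 0)
    (μ : E → ℝ) (hμ : ∀ x : E, μ x = (1/2) * ψ x (J x x)) :
    ∀ x ∈ U, DifferentiableAt ℝ μ x ∧
      ∀ v : E, fderiv ℝ μ x v = -ψ (J x x) v := by
  intro x hx
  have hderiv : HasFDerivAt (fun y => ψ y (J y y)) _ x :=
    ψ.hasFDerivAt.clm_apply ((hdiff x hx).hasFDerivAt.clm_apply (hasFDerivAt_id x))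
  have hμderiv := hderiv.const_mul (1 / 2 : ℝ)
  rw [← funext hμ] at hμderiv
  refine ⟨hμderiv.differentiableAt, fun v => ?_⟩
  have hvanish : fderiv ℝ J x v x = 0 := by
    rw [hsym x hx, hconical x hx, zero_apply]
  have hskew : ψ x (J x v) = -ψ (J x x) v := by
    rw [← hherm x hx x (J x v), hJ x hx, map_neg]
  rw [hμderiv.fderiv]
  simp [hvanish, hskew, hanti v (J x x)]
  ring
end

section
/- Let E be a real normed space, U ⊆ E open, ψ : E →L[ℝ] E →L[ℝ] ℝ a continuous bilinear form which is antisymmetric (ψ(u,v) = −ψ(v,u)), and J : U → (E →L[ℝ] E) differentiable with (J x) ∘ (J x) = −id and ψ((J x) u, (J x) v) = ψ(u,v) for all x ∈ U and u, v ∈ E. Define the one-form α : U → (E →L[ℝ] ℝ) by (α x) v := ψ((J x) x, (J x) v). Then α is differentiable and its exterior derivative equals 2ψ: for all x ∈ U and u, v ∈ E, (fderiv ℝ α x u) v − (fderiv ℝ α x v) u = 2 ψ(u,v). -/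
/-- the identity `d((ι_Z ψ) ∘ J) = 2ψ` for `Z = Jξ` on a conical special
complex manifold with `J`-hermitian two-form `ψ`, in affine coordinates. -/
theorem exterior_derivative_of_iota_Z_psi_J
    {E : Type*} [NormedAddCommGroup E] [NormedSpace ℝ E]
    (U : Set E) (hU : IsOpen U)
    (ψ : E →L[ℝ] E →L[ℝ] ℝ)
    (hanti : ∀ u v : E, ψ u v = -ψ v u)
    (J : E → (E →L[ℝ] E))
    (hdiff : ∀ x ∈ U, DifferentiableAt ℝ J x)
    (hJ : ∀ x ∈ U, ∀ v : E, J x (J x v) = -v)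
    (hherm : ∀ x ∈ U, ∀ u v : E, ψ (J x u) (J x v) = ψ u v)
    (α : E → (E →L[ℝ] ℝ))
    (hα : ∀ x : E, α x = (ψ (J x x)).comp (J x)) :
    ∀ x ∈ U, DifferentiableAt ℝ α x ∧
      ∀ u v : E, fderiv ℝ α x u v - fderiv ℝ α x v u = 2 * ψ u v := by
  intro x hx
  have heq : α =ᶠ[nhds x] ψ := by
    filter_upwards [hU.mem_nhds hx] with y hy
    ext v
    simpa [hα y] using hherm y hy y v
  have hderiv : HasFDerivAt α ψ x := ψ.hasFDerivAt.congr_of_eventuallyEq heq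
  refine ⟨hderiv.differentiableAt, fun u v => ?_⟩
  rw [hderiv.fderiv, hanti v u]
  ring
end

section
/- Let V be a real vector space, J : V → V ℝ-linear with J ∘ J = −id, and let A_X, A_Y : V → V be ℝ-linear endomorphisms satisfying A_X ∘ J = −J ∘ A_X and A_Y ∘ J = −J ∘ A_Y. For θ ∈ ℝ set R := (cos 2θ) • id + (sin 2θ) • J and define B_X := R ∘ A_X and B_Y := R ∘ A_Y. Then B_X ∘ B_Y = A_X ∘ A_Y. -/
/-- Lemma 7.6: `B² = A²` for `B = e^{2θJ} A`, where `A` anticommutes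
with `J` and `e^{2θJ} = (cos 2θ) id + (sin 2θ) J`. -/
theorem B_squared_eq_A_squared
    {V : Type*} [AddCommGroup V] [Module ℝ V]
    (J : V →ₗ[ℝ] V) (hJ : ∀ v : V, J (J v) = -v)
    (AX AY : V →ₗ[ℝ] V)
    (hAX : AX ∘ₗ J = -(J ∘ₗ AX))
    (hAY : AY ∘ₗ J = -(J ∘ₗ AY))
    (θ : ℝ) :
    let R : V →ₗ[ℝ] V := Real.cos (2 * θ) • LinearMap.id + Real.sin (2 * θ) • J
    (R ∘ₗ AX) ∘ₗ (R ∘ₗ AY) = AX ∘ₗ AY := by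
  intro R
  ext v
  have hanti (w : V) : AX (J w) = -J (AX w) := by
    simpa using LinearMap.congr_fun hAX w
  simp only [R, LinearMap.comp_apply, LinearMap.add_apply, LinearMap.smul_apply,
    LinearMap.id_apply, map_add, map_smul, map_neg, hanti, hJ]
  generalize AX (AY v) = u
  linear_combination (norm := module) Real.cos_sq_add_sin_sq (2 * θ) • u
end

section
/- Let n be a natural number and g : (Fin (n+1) → ℂ) → ℂ a map that is ℂ-differentiable at a point z. Define F : (Fin (n+1) → ℂ) → ((Fin (n+1) → ℝ) × ℝ × (Fin n → ℝ)) by F w := ((fun i => (w i).re), (g w).re, (fun j => (w (j.succ)).im)). If the imaginary part of fderiv ℂ g z (Pi.single 0 1) is nonzero, then F is ℝ-differentiable at z and the ℝ-linear map fderiv ℝ F z is bijective; in particular F is an immersion at z. -/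
/-- The real-linear map `v ↦ (Re v₀,…,Re vₙ, Re G(v), Im v₁,…,Im vₙ)` attached to a
complex-linear form `G`. -/
noncomputable def realPartCLM {n : ℕ} (G : (Fin (n + 1) → ℂ) →L[ℂ] ℂ) :
    (Fin (n + 1) → ℂ) →L[ℝ] ((Fin (n + 1) → ℝ) × ℝ × (Fin n → ℝ)) :=
  (ContinuousLinearMap.pi fun i =>
      Complex.reCLM.comp (ContinuousLinearMap.proj (R := ℝ) (φ := fun _ => ℂ) i)).prod
    ((Complex.reCLM.comp (G.restrictScalars ℝ)).prod
      (ContinuousLinearMap.pi fun j : Fin n =>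
        Complex.imCLM.comp (ContinuousLinearMap.proj (R := ℝ) (φ := fun _ => ℂ) j.succ)))

theorem realPartCLM_apply {n : ℕ} (G : (Fin (n + 1) → ℂ) →L[ℂ] ℂ) (v : Fin (n + 1) → ℂ) :
    realPartCLM G v =
      ((fun i => (v i).re), (G v).re, (fun j : Fin n => (v j.succ).im)) :=
  rfl

theorem realPartCLM_injective {n : ℕ} (G : (Fin (n + 1) → ℂ) →L[ℂ] ℂ)
    (h0 : (G (Pi.single 0 1)).im ≠ 0) : Function.Injective (realPartCLM G) := by
  rw [injective_iff_map_eq_zero]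
  intro v hv
  rw [realPartCLM_apply, Prod.mk_eq_zero, Prod.mk_eq_zero] at hv
  obtain ⟨hre, hG, him⟩ := hv
  have hsucc (j : Fin n) : v j.succ = 0 :=
    Complex.ext (congrFun hre j.succ) (congrFun him j)
  have hv : v = v 0 • Pi.single 0 1 := by
    ext i
    cases i using Fin.cases with
    | zero => simp
    | succ j => simp [hsucc]
  have hre0 : (v 0).re = 0 := congrFun hre 0
  have him0 : (v 0).im = 0 := by
    rw [hv, map_smul, smul_eq_mul, Complex.mul_re, hre0, zero_mul, zero_sub, neg_eq_zero] at hG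
    exact (mul_eq_zero.mp hG).resolve_right h0
  rw [hv, Complex.ext hre0 him0 (w := 0), zero_smul]

theorem realPartCLM_bijective {n : ℕ} (G : (Fin (n + 1) → ℂ) →L[ℂ] ℂ)
    (h0 : (G (Pi.single 0 1)).im ≠ 0) : Function.Bijective (realPartCLM G) := by
  have hinj := realPartCLM_injective G h0
  have hdim : Module.finrank ℝ (Fin (n + 1) → ℂ) =
      Module.finrank ℝ ((Fin (n + 1) → ℝ) × ℝ × (Fin n → ℝ)) := by
    simp only [Module.finrank_pi_fintype, Module.finrank_prod, Complex.finrank_real_complex,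
      Module.finrank_self, Finset.sum_const, Finset.card_univ, Fintype.card_fin, smul_eq_mul]
    ring
  exact ⟨hinj, (LinearMap.injective_iff_surjective_of_finrank_eq_finrank hdim
    (f := (realPartCLM G).toLinearMap)).mp hinj⟩

theorem hasFDerivAt_realPart {n : ℕ} {g : (Fin (n + 1) → ℂ) → ℂ} {z : Fin (n + 1) → ℂ}
    {G : (Fin (n + 1) → ℂ) →L[ℂ] ℂ} (hg : HasFDerivAt g G z) :
    HasFDerivAt (fun w : Fin (n + 1) → ℂ =>
      ((fun i => (w i).re), (g w).re, (fun j : Fin n => (w j.succ).im)))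
      (realPartCLM G) z := by
  have hRe := Complex.reCLM.hasFDerivAt.comp z (hg.restrictScalars ℝ)
  refine HasFDerivAt.prodMk ?_ (hRe.prodMk ?_)
  · exact hasFDerivAt_pi.2 fun i => ContinuousLinearMap.hasFDerivAt
      (Complex.reCLM.comp (ContinuousLinearMap.proj (R := ℝ) (φ := fun _ => ℂ) i))
  · exact hasFDerivAt_pi.2 fun j => ContinuousLinearMap.hasFDerivAt
      (Complex.imCLM.comp (ContinuousLinearMap.proj (R := ℝ) (φ := fun _ => ℂ) j.succ))


/-- Example 8.6: if `Im g₀(z) ≠ 0`, the map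
`w ↦ (Re w₀,…,Re wₙ, Re g(w), Im w₁,…,Im wₙ)` is an immersion (with bijective real
differential) at `z`. -/
theorem real_part_map_is_immersion (n : ℕ)
    (g : (Fin (n + 1) → ℂ) → ℂ) (z : Fin (n + 1) → ℂ)
    (hg : DifferentiableAt ℂ g z)
    (F : (Fin (n + 1) → ℂ) → ((Fin (n + 1) → ℝ) × ℝ × (Fin n → ℝ)))
    (hF : ∀ w, F w = ((fun i => (w i).re), (g w).re, (fun j : Fin n => (w j.succ).im)))
    (h0 : (fderiv ℂ g z (Pi.single 0 1)).im ≠ 0) :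
    DifferentiableAt ℝ F z ∧ Function.Bijective (fderiv ℝ F z) := by
  have hder : HasFDerivAt F (realPartCLM (fderiv ℂ g z)) z := by
    rw [funext hF]
    exact hasFDerivAt_realPart hg.hasFDerivAt
  refine ⟨hder.differentiableAt, ?_⟩
  rw [hder.fderiv]
  exact realPartCLM_bijective _ h0
end
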